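/- arXiv:1909.06882 — 2 statements merged into one kernel-verified Lean document; each statement's English description precedes it below -/
import Mathlib

section
/- Let F be a division ring, α ∈ F, and f, g ∈ F[z]. If g^ℓ(α) = 0, then (gf)^ℓ(α) = 0; if g^ℓ(α) ≠ 0, then (gf)^ℓ(α) = g^ℓ(α) · f^ℓ(g^ℓ(α)⁻¹ α g^ℓ(α)). -/
open Polynomial

/-- Left evaluation of a polynomial `f = Σ zʲ fⱼ` at `a`: `f^ℓ(a) = Σ aʲ fⱼ`.
(Mathlib's `Polynomial.eval` is the right evaluation `Σ fⱼ aʲ`.) -/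
noncomputable def lEval {F : Type*} [DivisionRing F] (a : F) (f : F[X]) : F :=
  f.sum fun j c => a ^ j * c

theorem lEval_add {F : Type*} [DivisionRing F] (a : F) (f g : F[X]) :
    lEval a (f + g) = lEval a f + lEval a g :=
  sum_add_index f g _ (fun _ => mul_zero _) fun _ _ _ => mul_add _ _ _

theorem lEval_monomial {F : Type*} [DivisionRing F] (a : F) (n : ℕ) (c : F) :
    lEval a (monomial n c) = a ^ n * c :=
  sum_monomial_index _ _ (mul_zero _)

theorem lEval_mul_monomial {F : Type*} [DivisionRing F] (a : F) (g : F[X]) (n : ℕ) (c : F) :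
    lEval a (g * monomial n c) = a ^ n * lEval a g * c := by
  induction g using Polynomial.induction_on' with
  | add p q hp hq => rw [add_mul, lEval_add, hp, hq, lEval_add, mul_add, add_mul]
  | monomial m d =>
    rw [monomial_mul_monomial, lEval_monomial, lEval_monomial, add_comm, pow_add]
    simp only [mul_assoc]

/-- Left product formula: if g^ℓ(α)=0 then (gf)^ℓ(α)=0; otherwise
(gf)^ℓ(α) = g^ℓ(α)·f^ℓ(g^ℓ(α)⁻¹ α g^ℓ(α)). -/
theorem stmt2 {F : Type*} [DivisionRing F] (α : F) (f g : F[X]) :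
    (lEval α g = 0 → lEval α (g * f) = 0) ∧
    (lEval α g ≠ 0 →
      lEval α (g * f) = lEval α g * lEval ((lEval α g)⁻¹ * α * lEval α g) f) := by
  induction f using Polynomial.induction_on' with
  | add p q hp hq =>
    refine ⟨fun h => ?_, fun h => ?_⟩
    · rw [mul_add, lEval_add, hp.1 h, hq.1 h, add_zero]
    · rw [mul_add, lEval_add, hp.2 h, hq.2 h, lEval_add, mul_add]
  | monomial n c =>
    refine ⟨fun h => ?_, fun h => ?_⟩
    · rw [lEval_mul_monomial, h, mul_zero, zero_mul]
    · have hconj : SemiconjBy (lEval α g) ((lEval α g)⁻¹ * α * lEval α g) α := by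
        rw [SemiconjBy, mul_assoc, mul_inv_cancel_left₀ h]
      rw [lEval_mul_monomial, lEval_monomial, ← mul_assoc, (hconj.pow_right n).eq]
end

section
/- Let F be a division ring, α ∈ F algebraic over the center with minimal central polynomial χ, and β conjugate to α. Then the Sylvester equation αx − xβ = γ has a solution x ∈ F if and only if ((L_α χ)·γ)^r(β) = 0. -/
open Polynomial

/-- χ is the minimal central polynomial of α: monic with central coefficients,
vanishing at α, of least degree among such. -/
def IsMinCentralPoly {F : Type*} [DivisionRing F] (α : F) (χ : F[X]) : Prop :=
  χ.Monic ∧ (∀ n, χ.coeff n ∈ Subring.center F) ∧ χ.eval α = 0 ∧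
    ∀ g : F[X], g.Monic → (∀ n, g.coeff n ∈ Subring.center F) → g.eval α = 0 →
      χ.degree ≤ g.degree

namespace Polynomial

section Sandwich

variable {F : Type*} [DivisionRing F]

/-- The action of `F[X]` on `F` in which scalars act by left multiplication and `X` acts by right
multiplication by `a`. -/
noncomputable def sandwich (a : F) : F[X] →+* AddMonoid.End F :=
  eval₂RingHom' (Module.toAddMonoidEnd F F) (AddMonoidHom.mulRight a) fun c =>
    AddMonoidHom.ext fun y => (mul_assoc c y a).symm

variable (a : F)

@[simp]
theorem sandwich_C (c y : F) : sandwich a (C c) y = c * y :=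
  DFunLike.congr_fun (eval₂_C (Module.toAddMonoidEnd F F) (AddMonoidHom.mulRight a)) y

@[simp]
theorem sandwich_X (y : F) : sandwich a X y = y * a :=
  DFunLike.congr_fun (eval₂_X (Module.toAddMonoidEnd F F) (AddMonoidHom.mulRight a)) y

theorem sandwich_add (p q : F[X]) (y : F) :
    sandwich a (p + q) y = sandwich a p y + sandwich a q y := by
  rw [map_add]; rfl

theorem sandwich_sub (p q : F[X]) (y : F) :
    sandwich a (p - q) y = sandwich a p y - sandwich a q y := by
  rw [map_sub]; rfl

theorem sandwich_mul (p q : F[X]) (y : F) :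
    sandwich a (p * q) y = sandwich a p (sandwich a q y) := by
  rw [map_mul]; rfl

theorem sandwich_X_sub_C (c y : F) : sandwich a (X - C c) y = y * a - c * y := by
  rw [sandwich_sub, sandwich_X, sandwich_C]

theorem sandwich_mul_right {d : F} (hd : Commute a d) (p : F[X]) (y : F) :
    sandwich a p (y * d) = sandwich a p y * d := by
  induction p using Polynomial.induction_on generalizing y with
  | C c => simp [mul_assoc]
  | add p q hp hq => simp only [sandwich_add, hp, hq, add_mul]
  | monomial n c ih =>
    rw [pow_succ, ← mul_assoc, sandwich_mul a (C c * X ^ n), sandwich_mul a (C c * X ^ n),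
      sandwich_X, sandwich_X, mul_assoc, ← hd.eq, ← mul_assoc, ih]

theorem eval_mul_C_conj (p : F[X]) {h : F} (hh : h ≠ 0) (y : F) :
    (p * C y).eval (h * a * h⁻¹) = sandwich a p (y * h) * h⁻¹ := by
  induction p using Polynomial.induction_on generalizing y with
  | C c => rw [← C_mul, eval_C, sandwich_C, mul_assoc, mul_assoc, mul_inv_cancel₀ hh, mul_one]
  | add p q hp hq => simp only [sandwich_add, eval_add, hp, hq, add_mul]
  | monomial n c ih =>
    have : C c * X ^ (n + 1) * C y = C c * X ^ n * C y * X := by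
      rw [pow_succ, mul_assoc, mul_assoc, X_mul_C, mul_assoc, mul_assoc]
    rw [this, eval_mul_X, ih, pow_succ, ← mul_assoc (C c), sandwich_mul a (C c * X ^ n), sandwich_X,
      sandwich_mul_right a (Commute.refl a)]
    simp [mul_assoc, hh]

theorem sandwich_one_eq_eval (p : F[X]) : sandwich a p 1 = p.eval a := by
  simpa using (eval_mul_C_conj a p one_ne_zero 1).symm

theorem commute_C_of_coeff_mem_center {p : F[X]} (hp : ∀ n, p.coeff n ∈ Subring.center F)
    (c : F) : C c * p = p * C c := by
  ext n
  rw [coeff_C_mul, coeff_mul_C, Subring.mem_center_iff.mp (hp n)]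

theorem coeff_mem_center_of_commute_C {p : F[X]} (hp : ∀ c, C c * p = p * C c) (n : ℕ) :
    p.coeff n ∈ Subring.center F := by
  rw [Subring.mem_center_iff]
  intro c
  simpa using congrArg (coeff · n) (hp c)

theorem sandwich_eq_zero_of_commute_C {p : F[X]} (hp : ∀ c, C c * p = p * C c)
    (h0 : p.eval a = 0) (y : F) : sandwich a p y = 0 := by
  have : sandwich a (p * C y) 1 = 0 := by
    rw [← hp, sandwich_mul, sandwich_one_eq_eval, h0, map_zero]
  simpa [sandwich_mul] using this

/-- A nonzero polynomial of least degree annihilating `F` is central after normalization. -/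
theorem exists_central_of_sandwich_eq_zero {p : F[X]} (hp : p ≠ 0)
    (h0 : ∀ y, sandwich a p y = 0) :
    ∃ g : F[X], g.Monic ∧ (∀ n, g.coeff n ∈ Subring.center F) ∧ g.eval a = 0 ∧
      g.degree ≤ p.degree := by
  induction hd : p.degree using WellFoundedLT.induction generalizing p with
  | ind d ih =>
    subst hd
    have hlc : p.leadingCoeff⁻¹ ≠ 0 := inv_ne_zero (leadingCoeff_ne_zero.mpr hp)
    set g := C p.leadingCoeff⁻¹ * p with hg
    have hmonic : g.Monic := by
      rw [Monic, hg, leadingCoeff_mul, leadingCoeff_C,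
        inv_mul_cancel₀ (leadingCoeff_ne_zero.mpr hp)]
    have hdeg : g.degree = p.degree := by rw [hg, degree_mul, degree_C hlc, zero_add]
    have hg0 : ∀ y, sandwich a g y = 0 := fun y => by rw [hg, sandwich_mul, h0, map_zero]
    by_cases hcomm : ∀ c, C c * g = g * C c
    · exact ⟨g, hmonic, coeff_mem_center_of_commute_C hcomm,
        by rw [← sandwich_one_eq_eval, hg0], hdeg.le⟩
    · push Not at hcomm
      obtain ⟨c, hc⟩ := hcomm
      have hc0 : c ≠ 0 := by rintro rfl; simp at hc
      have hlt : (C c * g - g * C c).degree < p.degree := by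
        have h1 : (C c * g).degree = p.degree := by rw [degree_mul, degree_C hc0, zero_add, hdeg]
        have h2 : (g * C c).degree = p.degree := by rw [degree_mul, degree_C hc0, add_zero, hdeg]
        rw [← h1]
        refine degree_sub_lt_left (h1.trans h2.symm) ?_ ?_
        · exact mul_ne_zero (C_ne_zero.mpr hc0) hmonic.ne_zero
        · simp [leadingCoeff_mul, hmonic.leadingCoeff]
      obtain ⟨g', h1, h2, h3, h4⟩ := ih _ hlt (sub_ne_zero.mpr hc)
        (fun y => by
          rw [sandwich_sub, sandwich_mul a (C c) g, sandwich_mul a g (C c), hg0, hg0, map_zero,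
            sub_zero]) rfl
      exact ⟨g', h1, h2, h3, h4.trans hlt.le⟩

/-- Left division by `X - C a`. -/
theorem exists_eq_X_sub_C_mul_add_C (p : F[X]) : ∃ (s : F[X]) (c : F), p = (X - C a) * s + C c := by
  induction p using Polynomial.induction_on with
  | C c => exact ⟨0, c, by simp⟩
  | add p q hp hq =>
    obtain ⟨s, c, rfl⟩ := hp
    obtain ⟨t, d, rfl⟩ := hq
    exact ⟨s + t, c + d, by rw [mul_add, C_add]; abel⟩
  | monomial n c ih =>
    obtain ⟨s, d, hs⟩ := ih
    refine ⟨s * X + C d, a * d, ?_⟩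
    rw [pow_succ, ← mul_assoc, hs]
    simp only [mul_add, add_mul, sub_mul, mul_assoc, C_mul, X_mul_C]
    abel

theorem commute_of_commute_X_sub_C_mul_add_C {s : F[X]} {c : F}
    (h : C a * ((X - C a) * s + C c) = ((X - C a) * s + C c) * C a) : a * c = c * a := by
  have hX : C a * (X - C a) = (X - C a) * C a := by rw [mul_sub, sub_mul, X_mul_C]
  have key : (X - C a) * (C a * s - s * C a) = C (c * a - a * c) := by
    rw [mul_add, add_mul, ← mul_assoc, hX] at h
    rw [mul_sub, C_sub, C_mul, C_mul, ← mul_assoc, ← mul_assoc, sub_eq_sub_iff_add_eq_add, h]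
    abel
  by_cases hs : C a * s - s * C a = 0
  · rw [hs, mul_zero, eq_comm, C_eq_zero, sub_eq_zero] at key
    exact key.symm
  · have h1 := congrArg natDegree key
    rw [natDegree_mul (X_sub_C_ne_zero a) hs, natDegree_X_sub_C, natDegree_C] at h1
    omega

/-- Splitting off the largest power of `X - C a` on the left. -/
theorem exists_eq_X_sub_C_pow_mul {p : F[X]} (hp : p ≠ 0) :
    ∃ (k : ℕ) (s : F[X]) (c : F), c ≠ 0 ∧ p = (X - C a) ^ k * ((X - C a) * s + C c) := by
  induction hd : p.natDegree using Nat.strong_induction_on generalizing p with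
  | _ d ih =>
    subst hd
    obtain ⟨s, c, hs⟩ := exists_eq_X_sub_C_mul_add_C a p
    by_cases hc : c = 0
    · rw [hc, C_0, add_zero] at hs
      have hs0 : s ≠ 0 := by rintro rfl; simp [hs] at hp
      have hlt : s.natDegree < p.natDegree := by
        rw [hs, natDegree_mul (X_sub_C_ne_zero a) hs0, natDegree_X_sub_C]; omega
      obtain ⟨k, t, c, hc, ht⟩ := ih _ hlt hs0 rfl
      exact ⟨k + 1, t, c, hc, by rw [hs, pow_succ', mul_assoc, ← ht]⟩
    · exact ⟨0, s, c, hc, by rw [pow_zero, one_mul, ← hs]⟩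

/-- Exactness of the complex `X - C a`, `q` on `F`, where `(X - C a) * q` is the minimal central
polynomial of `a`. -/
theorem exists_sandwich_X_sub_C_eq {q : F[X]} (hcomm : C a * q = q * C a)
    (hzero : ∀ y, sandwich a ((X - C a) * q) y = 0) (hne : ∃ y, sandwich a q y ≠ 0)
    {y : F} (hy : sandwich a q y = 0) : ∃ x, sandwich a (X - C a) x = y := by
  have hq0 : q ≠ 0 := by rintro rfl; simp at hne
  obtain ⟨k, s, c, hc, hk⟩ := exists_eq_X_sub_C_pow_mul a hq0
  have hX : Commute (C a) (X - C a) := by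
    rw [Commute, SemiconjBy, mul_sub, sub_mul, X_mul_C]
  have hca : a * c = c * a := by
    refine commute_of_commute_X_sub_C_mul_add_C a (s := s) ?_
    refine mul_left_cancel₀ (pow_ne_zero k (X_sub_C_ne_zero a)) ?_
    rw [← mul_assoc, ← mul_assoc, ← hk, ← hcomm, hk, ← mul_assoc, (hX.pow_right k).eq]
  -- `q` maps onto the centralizer of `a`
  have hsurj : ∀ t, sandwich a (X - C a) t = 0 → ∃ z, sandwich a q z = t := by
    obtain ⟨y₀, hy₀⟩ := hne
    have h₀ := hzero y₀
    rw [sandwich_mul, sandwich_X_sub_C, sub_eq_zero] at h₀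
    intro t ht
    rw [sandwich_X_sub_C, sub_eq_zero] at ht
    have hcom : Commute a ((sandwich a q y₀)⁻¹ * t) :=
      Commute.mul_right (Commute.inv_right₀ h₀.symm) ht.symm
    exact ⟨y₀ * ((sandwich a q y₀)⁻¹ * t), by
      rw [sandwich_mul_right a hcom, mul_inv_cancel_left₀ hy₀]⟩
  have hpow : ∀ j ≤ k, ∀ z, sandwich a ((X - C a) ^ j) z = 0 →
      ∃ x, sandwich a (X - C a) x = z := by
    intro j
    induction j with
    | zero =>
      intro _ z hz
      exact ⟨0, by simpa using hz.symm⟩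
    | succ j ih =>
      intro hj z hz
      rw [pow_succ', sandwich_mul] at hz
      obtain ⟨w, hw⟩ := hsurj _ hz
      obtain ⟨m, rfl⟩ := Nat.exists_eq_add_of_le hj
      have hsplit : q = (X - C a) ^ j * ((X - C a) * ((X - C a) ^ m * ((X - C a) * s + C c))) := by
        rw [hk, pow_add, pow_succ]
        simp only [mul_assoc]
      set w' := sandwich a ((X - C a) ^ m * ((X - C a) * s + C c)) w
      have hw' : sandwich a ((X - C a) ^ j) (sandwich a (X - C a) w') =
          sandwich a ((X - C a) ^ j) z := by
        rw [← hw, hsplit, sandwich_mul _ ((X - C a) ^ j), sandwich_mul _ (X - C a)]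
      obtain ⟨x, hx⟩ := ih (by omega) (z - sandwich a (X - C a) w')
        (by rw [map_sub, hw', sub_self])
      exact ⟨x + w', by rw [map_add, hx, sub_add_cancel]⟩
  rw [hk, sandwich_mul] at hy
  obtain ⟨x, hx⟩ := hpow k le_rfl _ hy
  refine ⟨c⁻¹ * (x - sandwich a s y), ?_⟩
  have hcy : sandwich a (X - C a) (x - sandwich a s y) = c * y := by
    rw [map_sub, hx, sandwich_add, sandwich_mul, sandwich_C, add_sub_cancel_left]
  have hinv : a * c⁻¹ = c⁻¹ * a := (Commute.inv_right₀ hca : Commute a c⁻¹)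
  rw [sandwich_X_sub_C] at hcy ⊢
  rw [← mul_assoc a, hinv, mul_assoc, mul_assoc, ← mul_sub, hcy, inv_mul_cancel_left₀ hc]

end Sandwich

end Polynomial

theorem lEval_eq_eval_of_coeff_mem_center {F : Type*} [DivisionRing F] (a : F) {f : F[X]}
    (hf : ∀ n, f.coeff n ∈ Subring.center F) : lEval a f = f.eval a := by
  rw [lEval, eval_eq_sum]
  exact Finset.sum_congr rfl fun n _ => Subring.mem_center_iff.mp (hf n) _

/-- If β is conjugate to α, the Sylvester equation αx − xβ = γ has a solution
iff ((L_α χ)·γ)^r(β) = 0. -/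
theorem stmt15 {F : Type*} [DivisionRing F] (α β γ : F) (χ : F[X])
    (hχ : IsMinCentralPoly α χ) (h : F) (hh : h ≠ 0) (hβ : β = h * α * h⁻¹)
    (q : F[X]) (hq : χ = C (lEval α χ) + (X - C α) * q) :
    (∃ x : F, α * x - x * β = γ) ↔ (q * C γ).eval β = 0 := by
  obtain ⟨hmonic, hcen, hroot, hmin⟩ := hχ
  rw [lEval_eq_eval_of_coeff_mem_center α hcen, hroot, C_0, zero_add] at hq
  have hχcomm := commute_C_of_coeff_mem_center hcen
  have hq0 : q ≠ 0 := by
    rintro rfl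
    exact hmonic.ne_zero (by simpa using hq)
  have hqcomm : C α * q = q * C α := by
    refine mul_left_cancel₀ (X_sub_C_ne_zero α) ?_
    rw [← mul_assoc, ← mul_assoc, ← hq, ← hχcomm, hq, ← mul_assoc, mul_sub, sub_mul, X_mul_C]
  have hzero : ∀ y, sandwich α ((X - C α) * q) y = 0 := by
    rw [← hq]
    exact sandwich_eq_zero_of_commute_C α hχcomm hroot
  have hne : ∃ y, sandwich α q y ≠ 0 := by
    by_contra! hall
    obtain ⟨g, h1, h2, h3, h4⟩ := exists_central_of_sandwich_eq_zero α hq0 hall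
    have hle := natDegree_le_natDegree ((hmin g h1 h2 h3).trans h4)
    rw [hq, natDegree_mul (X_sub_C_ne_zero α) hq0, natDegree_X_sub_C] at hle
    omega
  rw [hβ, eval_mul_C_conj α q hh, mul_eq_zero_iff_right (inv_ne_zero hh)]
  constructor
  · rintro ⟨x, rfl⟩
    have hx : (α * x - x * (h * α * h⁻¹)) * h = -sandwich α (X - C α) (x * h) := by
      rw [sandwich_X_sub_C]
      simp [sub_mul, mul_assoc, hh]
    have hswap : q * (X - C α) = (X - C α) * q := by
      rw [mul_sub, sub_mul, hqcomm, X_mul]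
    rw [hx, map_neg, ← sandwich_mul, hswap, hzero, neg_zero]
  · intro hγ
    obtain ⟨x, hx⟩ := exists_sandwich_X_sub_C_eq α hqcomm hzero hne hγ
    refine ⟨-(x * h⁻¹), mul_right_cancel₀ hh ?_⟩
    rw [← hx, sandwich_X_sub_C]
    simp [add_mul, mul_assoc, hh]
    abel
end
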